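/- For ω = e¹² + e³⁴ + e⁵⁶ and φ = e¹⁴⁶ + e²³⁶ + e²⁴⁵ on ℝ⁶, the symmetric bilinear form q(v₁,v₂) = (ι_{v₁}φ ∧ ι_{v₂}φ ∧ ω)/(ω³/3!) is positive semi-definite with kernel of dimension exactly 3, i.e. its signature is (3,3,0) (3-dim kernel, 3 positive directions, no negative directions). -/

import Mathlib

noncomputable section

/-- The model 6-dimensional real vector space. -/
abbrev V6 := Fin 6 → ℝ

/-- Alternating k-forms on V6. -/
abbrev Form (k : ℕ) := AlternatingMap ℝ V6 ℝ (Fin k)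

/-- Wedge product of alternating forms (determinant convention). -/
noncomputable def wedge {a b : ℕ} (φ : Form a) (ψ : Form b) : Form (a + b) :=
  AlternatingMap.domDomCongr finSumFinEquiv
    ((TensorProduct.lid ℝ ℝ).toLinearMap.compAlternatingMap (AlternatingMap.domCoprod φ ψ))

infixl:70 " ⋏ " => wedge

/-- Interior product (contraction) of a form with a vector. -/
noncomputable def iota (v : V6) {k : ℕ} (φ : Form (k + 1)) : Form k :=
  AlternatingMap.curryLeft φ v

/-- The standard dual basis 1-forms e¹, …, e⁶ (0-indexed). -/
noncomputable def e (i : Fin 6) : Form 1 :=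
  AlternatingMap.ofSubsingleton ℝ V6 ℝ 0 (LinearMap.proj i)

/-- The standard basis vectors e₁, …, e₆ (0-indexed). -/
def b (i : Fin 6) : V6 := Pi.single i 1

/-- The standard volume form e¹∧e²∧e³∧e⁴∧e⁵∧e⁶. -/
noncomputable def vol : Form 6 := e 0 ⋏ e 1 ⋏ e 2 ⋏ e 3 ⋏ e 4 ⋏ e 5

/-- The standard symplectic form ω = e¹² + e³⁴ + e⁵⁶. -/
noncomputable def ω : Form 2 := e 0 ⋏ e 1 + e 2 ⋏ e 3 + e 4 ⋏ e 5

/-- The symplectic volume form ω³/3!. -/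
noncomputable def volω : Form 6 := (6 : ℝ)⁻¹ • (ω ⋏ ω ⋏ ω : Form 6)

open Function

/-- The monomial form `e^{I 0} ∧ ⋯ ∧ e^{I (k-1)}`, as an alternatized product of coordinates. -/
def monomialForm {k : ℕ} (I : Fin k → Fin 6) : Form k :=
  MultilinearMap.alternatization
    ((MultilinearMap.mkPiAlgebra ℝ (Fin k) ℝ).compLinearMap fun j => LinearMap.proj (I j))

theorem monomialForm_apply {k : ℕ} (I : Fin k → Fin 6) (x : Fin k → V6) :
    monomialForm I x = (Matrix.of fun i j => x i (I j)).det := by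
  simp [monomialForm, MultilinearMap.alternatization_apply, Matrix.det_apply]

theorem e_eq_monomialForm (i : Fin 6) : e i = monomialForm ![i] := by
  ext x
  simp [monomialForm_apply, e]

theorem monomialForm_wedge {k l : ℕ} (I : Fin k → Fin 6) (J : Fin l → Fin 6) :
    monomialForm I ⋏ monomialForm J = monomialForm (Fin.append I J) := by
  ext x
  simp only [wedge, monomialForm, ← MultilinearMap.domCoprod_alternization]
  simp only [AlternatingMap.domDomCongr_apply, LinearMap.compAlternatingMap_apply,
    MultilinearMap.alternatization_apply, map_sum]
  refine Fintype.sum_equiv (Equiv.permCongr finSumFinEquiv) _ _ fun σ => ?_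
  rcases Int.units_eq_one_or (Equiv.Perm.sign σ) with h | h <;>
    simp [Fin.prod_univ_add, Equiv.permCongr_apply, h]

theorem add_wedge {k l : ℕ} (α β : Form k) (γ : Form l) : (α + β) ⋏ γ = α ⋏ γ + β ⋏ γ := by
  ext x
  simp [wedge, ← AlternatingMap.domCoprod'_apply, TensorProduct.add_tmul]

theorem wedge_add {k l : ℕ} (α : Form k) (β γ : Form l) : α ⋏ (β + γ) = α ⋏ β + α ⋏ γ := by
  ext x
  simp [wedge, ← AlternatingMap.domCoprod'_apply, TensorProduct.tmul_add]

theorem smul_wedge {k l : ℕ} (c : ℝ) (α : Form k) (β : Form l) : (c • α) ⋏ β = c • (α ⋏ β) := by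
  ext x
  simp [wedge, ← AlternatingMap.domCoprod'_apply, ← TensorProduct.smul_tmul']

theorem wedge_smul {k l : ℕ} (c : ℝ) (α : Form k) (β : Form l) : α ⋏ (c • β) = c • (α ⋏ β) := by
  ext x
  simp [wedge, ← AlternatingMap.domCoprod'_apply]

theorem iota_add (v : V6) {k : ℕ} (α β : Form (k + 1)) :
    iota v (α + β) = iota v α + iota v β := by
  simp [iota]

theorem iota_monomialForm_three (v : V6) (i j k : Fin 6) :
    iota v (monomialForm ![i, j, k]) =
      v i • monomialForm ![j, k] + (-v j) • monomialForm ![i, k] +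
        v k • monomialForm ![i, j] := by
  ext x
  simp [iota, monomialForm_apply, Matrix.det_fin_three, Matrix.det_fin_two]
  ring

theorem monomialForm_basis_of_not_injective {I : Fin (2 + 2 + 2) → Fin 6} (hI : ¬ Injective I) :
    monomialForm I b = 0 := by
  obtain ⟨i, j, hij, hne⟩ : ∃ i j, I i = I j ∧ i ≠ j := by
    simpa [Injective] using hI
  rw [monomialForm_apply]
  exact Matrix.det_zero_of_column_eq hne fun r => by simp [hij]

theorem monomialForm_basis_perm (σ : Equiv.Perm (Fin 6)) :
    monomialForm σ b = ((Equiv.Perm.sign σ : ℤ) : ℝ) := by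
  rw [monomialForm_apply, ← Equiv.Perm.sign_inv, ← Matrix.det_permutation]
  congr 1
  ext i j
  simp [b, Pi.single_apply, Equiv.toPEquiv_apply, PEquiv.toMatrix_apply,
    Equiv.eq_symm_apply, eq_comm]

/-- The hypotheses say that `I` is an even permutation. -/
theorem monomialForm_basis_of_even {I : Fin (2 + 2 + 2) → Fin 6} (hI : Injective I)
    (hs : ∏ i, ∏ j ∈ Finset.Ioi i, (if I i < I j then (1 : ℤˣ) else -1) = 1) :
    monomialForm I b = 1 := by
  have h := monomialForm_basis_perm (Equiv.ofBijective I (Finite.injective_iff_bijective.1 hI))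
  rw [Equiv.Perm.sign_eq_prod_prod_Ioi] at h
  simpa [hs] using h

theorem omega_eq_monomialForm :
    ω = monomialForm ![0, 1] + monomialForm ![2, 3] + monomialForm ![4, 5] := by
  have h (i j : Fin 6) : e i ⋏ e j = monomialForm ![i, j] := by
    rw [e_eq_monomialForm, e_eq_monomialForm, monomialForm_wedge]
    congr 1
    ext k
    fin_cases k <;> rfl
  simp only [ω, h]

theorem e_wedge_e_wedge_e (i j k : Fin 6) :
    e i ⋏ e j ⋏ e k = monomialForm ![i, j, k] := by
  simp only [e_eq_monomialForm, monomialForm_wedge]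
  congr 1
  ext l
  fin_cases l <;> rfl

theorem volω_basis : volω b = 1 := by
  have h : (ω ⋏ ω ⋏ ω) b = 6 := by
    simp only [omega_eq_monomialForm, add_wedge, wedge_add, monomialForm_wedge,
      AlternatingMap.add_apply]
    simp (disch := decide) only [monomialForm_basis_of_not_injective, monomialForm_basis_of_even]
    norm_num
  change (6 : ℝ)⁻¹ * (ω ⋏ ω ⋏ ω) b = 1
  rw [h]
  norm_num

theorem iota_wedge_iota_wedge_omega_basis (v w : V6) {φ : Form 3}
    (hφ : φ = monomialForm ![0, 3, 5] + monomialForm ![1, 2, 5] + monomialForm ![1, 3, 4]) :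
    (iota v φ ⋏ iota w φ ⋏ ω) b = 2 * (v 1 * w 1 + v 3 * w 3 + v 5 * w 5) := by
  simp only [hφ, omega_eq_monomialForm, iota_add, iota_monomialForm_three, add_wedge, wedge_add,
    smul_wedge, wedge_smul, monomialForm_wedge, AlternatingMap.add_apply,
    AlternatingMap.smul_apply]
  simp (disch := decide) only [monomialForm_basis_of_not_injective, monomialForm_basis_of_even]
  simp only [smul_eq_mul]
  ring

/-- Projection onto the coordinates with indices `1, 3, 5`. -/
def oddCoords : V6 →ₗ[ℝ] (Fin 3 → ℝ) := LinearMap.funLeft ℝ ℝ ![1, 3, 5]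

/-- Inclusion of the coordinate subspace with indices `1, 3, 5`. -/
def oddIncl : (Fin 3 → ℝ) →ₗ[ℝ] V6 :=
  LinearMap.pi ![0, LinearMap.proj 0, 0, LinearMap.proj 1, 0, LinearMap.proj 2]

theorem oddCoords_oddIncl (y : Fin 3 → ℝ) : oddCoords (oddIncl y) = y := by
  ext i
  fin_cases i <;> simp [oddCoords, oddIncl, LinearMap.funLeft_apply]

theorem finrank_ker_oddCoords : Module.finrank ℝ (LinearMap.ker oddCoords) = 3 := by
  have h := oddCoords.finrank_range_add_finrank_ker
  rw [LinearMap.range_eq_top.2 fun y => ⟨_, oddCoords_oddIncl y⟩] at h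
  simp at h
  omega

theorem finrank_range_oddIncl : Module.finrank ℝ (LinearMap.range oddIncl) = 3 := by
  rw [LinearMap.finrank_range_of_inj (LeftInverse.injective oddCoords_oddIncl)]
  simp

/-- For ω = e¹² + e³⁴ + e⁵⁶ and φ = e¹⁴⁶ + e²³⁶ + e²⁴⁵, the symmetric bilinear form q
with q(v₁,v₂)·(ω³/3!) = ι_{v₁}φ ∧ ι_{v₂}φ ∧ ω is positive semi-definite with kernel of
dimension exactly 3 and a 3-dimensional subspace on which it is positive definite:
its signature is (3,3,0). -/
theorem q_signature_O0plus (φ : Form 3) (B : V6 →ₗ[ℝ] V6 →ₗ[ℝ] ℝ)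
    (hφ : φ = e 0 ⋏ e 3 ⋏ e 5 + e 1 ⋏ e 2 ⋏ e 5 + e 1 ⋏ e 3 ⋏ e 4)
    (hB : ∀ v₁ v₂ : V6, (iota v₁ φ ⋏ iota v₂ φ ⋏ ω : Form 6) = B v₁ v₂ • volω) :
    (∀ v : V6, 0 ≤ B v v) ∧
    Module.finrank ℝ (LinearMap.ker B) = 3 ∧
    ∃ P : Submodule ℝ V6, Module.finrank ℝ P = 3 ∧
      ∀ v ∈ P, v ≠ 0 → 0 < B v v := by
  have hφ' : φ = monomialForm ![0, 3, 5] + monomialForm ![1, 2, 5] + monomialForm ![1, 3, 4] := by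
    rw [hφ, e_wedge_e_wedge_e, e_wedge_e_wedge_e, e_wedge_e_wedge_e]
  have hq (v w : V6) : B v w = 2 * (oddCoords v ⬝ᵥ oddCoords w) := by
    have h := congrArg (fun α : Form 6 => α b) (hB v w)
    have h' := iota_wedge_iota_wedge_omega_basis v w hφ'
    simp only [AlternatingMap.smul_apply, volω_basis, smul_eq_mul, mul_one] at h
    rw [← h]
    refine h'.trans ?_
    simp [oddCoords, LinearMap.funLeft_apply, dotProduct, Fin.sum_univ_three]
  have hnonneg (y : Fin 3 → ℝ) : 0 ≤ y ⬝ᵥ y := Finset.sum_nonneg fun i _ => mul_self_nonneg (y i)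
  refine ⟨fun v => ?_, ?_, LinearMap.range oddIncl, finrank_range_oddIncl, ?_⟩
  · rw [hq]
    exact mul_nonneg zero_le_two (hnonneg _)
  · have hker : LinearMap.ker B = LinearMap.ker oddCoords := by
      ext v
      simp only [LinearMap.mem_ker]
      constructor
      · intro hv
        have h := hq v v
        rw [hv] at h
        simpa using h
      · intro hv
        refine LinearMap.ext fun w => ?_
        simp [hq, hv]
    rw [hker, finrank_ker_oddCoords]
  · rintro _ ⟨y, rfl⟩ hy
    rw [hq, oddCoords_oddIncl]
    have hy0 : y ≠ 0 := fun h => hy (by simp [h])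
    exact mul_pos two_pos ((hnonneg y).lt_of_ne' (by simpa using hy0))
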